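/- arXiv:2010.05414 — 3 statements merged into one kernel-verified Lean document; each statement's English description precedes it below -/
import Mathlib

section
/- Let (P_t)_{t>0} be a symmetric sub-Markovian semigroup on L²(μ) with associated Dirichlet form (E, F). Let δ ≥ 0 be a constant and θ : (0,∞) → (0,∞) a function with ∫_1^∞ ds/θ(s) < ∞ and ∫_0^1 ds/θ(s) = ∞. Assume the Nash-type inequality θ(‖f‖₂²) ≤ E(f, f) + δ ‖f‖₂² holds for every f ∈ F ∩ L¹(μ) with ‖f‖₁ ≤ 1 and f ≠ 0. Let φ : (0,∞) → (0,∞) be the inverse function of t ↦ ∫_t^∞ ds/θ(s). Then for every t > 0 and every f ∈ L¹(μ) ∩ L²(μ): ‖P_t f‖_∞ ≤ φ(t) e^{δ t} ‖f‖₁. -/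
open MeasureTheory ENNReal Filter Set
open scoped RealInnerProductSpace

/-- A symmetric sub-Markovian strongly continuous semigroup `(P_t)_{t>0}` on `L²(μ)`:
self-adjoint bounded operators with the semigroup property, `L²`-contractivity, strong
continuity as `t → 0+`, sub-Markovianity (`0 ≤ f ≤ 1` a.e. implies `0 ≤ P_t f ≤ 1` a.e.)
and `L¹`-contractivity on `L¹ ∩ L²`. -/
structure SymmSubMarkovSemigroup {E : Type*} [MeasurableSpace E] (μ : Measure E) where
  P : ℝ → Lp ℝ 2 μ →L[ℝ] Lp ℝ 2 μ
  symm : ∀ t, 0 < t → ∀ f g : Lp ℝ 2 μ, ⟪P t f, g⟫ = ⟪f, P t g⟫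
  semigroup : ∀ s, 0 < s → ∀ t, 0 < t → ∀ f, P (s + t) f = P s (P t f)
  l2_contraction : ∀ t, 0 < t → ∀ f, ‖P t f‖ ≤ ‖f‖
  strong_continuity : ∀ f : Lp ℝ 2 μ,
    Tendsto (fun t => P t f) (nhdsWithin 0 (Ioi 0)) (nhds f)
  subMarkov : ∀ t, 0 < t → ∀ f : Lp ℝ 2 μ, 0 ≤ᵐ[μ] (f : E → ℝ) → (f : E → ℝ) ≤ᵐ[μ] 1 →
    0 ≤ᵐ[μ] (P t f : E → ℝ) ∧ (P t f : E → ℝ) ≤ᵐ[μ] 1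
  l1_contraction : ∀ t, 0 < t → ∀ f : Lp ℝ 2 μ, MemLp (f : E → ℝ) 1 μ →
    eLpNorm (P t f : E → ℝ) 1 μ ≤ eLpNorm (f : E → ℝ) 1 μ

/-- The Dirichlet form associated with a symmetric sub-Markovian semigroup:
`E(f,f) = sup_{t>0} t⁻¹ ⟨f − P_t f, f⟩`, with values in `[0,∞]`. -/
noncomputable def dirichletForm {E : Type*} [MeasurableSpace E] {μ : Measure E}
    (S : SymmSubMarkovSemigroup μ) (f : Lp ℝ 2 μ) : ℝ≥0∞ :=
  ⨆ t : {t : ℝ // 0 < t}, ENNReal.ofReal ((t : ℝ)⁻¹ * ⟪f - S.P t f, f⟫)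

theorem aux_inner {E : Type*} [MeasurableSpace E] {μ : Measure E}
    (S : SymmSubMarkovSemigroup μ) (f : Lp ℝ 2 μ) (a r : ℝ) (ha : 0 < a) (hr : 0 < r) :
    ⟪S.P (a + 2 * r) f, S.P a f⟫ = ‖S.P (a + r) f‖ ^ 2 := by
  have h1 : S.P (a + 2 * r) f = S.P r (S.P (a + r) f) := by
    rw [← S.semigroup r hr (a + r) (by linarith)]
    congr 2; ring
  have h2 : S.P (a + r) f = S.P r (S.P a f) := by
    rw [← S.semigroup r hr a ha, add_comm]
  rw [h1, S.symm r hr, ← h2, real_inner_self_eq_norm_sq]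

theorem aux_mid {E : Type*} [MeasurableSpace E] {μ : Measure E}
    (S : SymmSubMarkovSemigroup μ) (f : Lp ℝ 2 μ) (a r : ℝ) (ha : 0 < a) (hr : 0 < r) :
    2 * ‖S.P (a + r) f‖ ^ 2 ≤ ‖S.P a f‖ ^ 2 + ‖S.P (a + 2 * r) f‖ ^ 2 := by
  have h := norm_sub_sq_real (S.P (a + 2 * r) f) (S.P a f)
  rw [aux_inner S f a r ha hr] at h
  nlinarith [sq_nonneg ‖S.P (a + 2 * r) f - S.P a f‖]

theorem aux_slope {E : Type*} [MeasurableSpace E] {μ : Measure E}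
    (S : SymmSubMarkovSemigroup μ) (f : Lp ℝ 2 μ) (a r D : ℝ) (ha : 0 < a) (hr : 0 < r)
    (hD : HasDerivAt (fun t => ‖S.P t f‖ ^ 2) D a) :
    r⁻¹ * (‖S.P a f‖ ^ 2 - ‖S.P (a + r) f‖ ^ 2) ≤ -D := by
  set u : ℝ → ℝ := fun t => ‖S.P t f‖ ^ 2 with hu
  have key : ∀ n : ℕ, r⁻¹ * (u a - u (a + r)) ≤
      -((r / 2 ^ n)⁻¹ * (u (a + r / 2 ^ n) - u a)) := by
    intro n
    induction n with
    | zero => simp only [pow_zero, div_one]; linarith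
    | succ n ih =>
      refine ih.trans ?_
      have hq : 0 < r / 2 ^ (n + 1) := by positivity
      have e : r / 2 ^ n = 2 * (r / 2 ^ (n + 1)) := by rw [pow_succ]; field_simp
      have h := aux_mid S f a _ ha hq
      rw [e]
      change 2 * u (a + _) ≤ u a + u (a + _) at h
      generalize r / 2 ^ (n + 1) = q at *
      rw [mul_inv]
      have : 0 < q⁻¹ := by positivity
      nlinarith
  have lim : Tendsto (fun n : ℕ => r / 2 ^ n) atTop (nhdsWithin 0 ({0}ᶜ)) := by
    rw [tendsto_nhdsWithin_iff]
    refine ⟨?_, Eventually.of_forall fun n => ?_⟩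
    · have := (tendsto_pow_atTop_nhds_zero_of_lt_one (r := (1/2 : ℝ)) (by norm_num)
        (by norm_num)).const_mul r
      simpa [div_eq_mul_inv] using this
    · have : 0 < r / 2 ^ n := by positivity
      exact this.ne'
  have h2 := (hasDerivAt_iff_tendsto_slope_zero.1 hD).comp lim
  exact ge_of_tendsto h2.neg (Eventually.of_forall fun n => by simpa using key n)

theorem aux_anti {E : Type*} [MeasurableSpace E] {μ : Measure E}
    (S : SymmSubMarkovSemigroup μ) (f : Lp ℝ 2 μ) :
    AntitoneOn (fun t => ‖S.P t f‖ ^ 2) (Ioi 0) := by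
  intro a ha b hb hab
  rcases hab.eq_or_lt with rfl | hab
  · exact le_rfl
  have : S.P b f = S.P (b - a) (S.P a f) := by
    rw [← S.semigroup _ (by linarith) a ha]; congr 2; ring
  simp only [this]
  have := S.l2_contraction (b - a) (by linarith) (S.P a f)
  gcongr

theorem aux_dirichlet {E : Type*} [MeasurableSpace E] {μ : Measure E}
    (S : SymmSubMarkovSemigroup μ) (f : Lp ℝ 2 μ) (a D c : ℝ) (ha : 0 < a)
    (hD : HasDerivAt (fun t => ‖S.P t f‖ ^ 2) D a) :
    dirichletForm S (c • S.P a f) ≤ ENNReal.ofReal (c ^ 2 * (-D / 2)) := by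
  refine iSup_le fun ⟨s, hs⟩ => ENNReal.ofReal_le_ofReal ?_
  have h := aux_slope S f a (s / 2) D ha (by positivity) hD
  have h1 := aux_inner S f a (s / 2) ha (by positivity)
  have e : S.P (a + 2 * (s / 2)) f = S.P s (S.P a f) := by
    rw [← S.semigroup s hs a ha]; congr 2; ring
  rw [e] at h1
  simp only [map_smul, ← smul_sub, real_inner_smul_left, real_inner_smul_right, inner_sub_left,
    real_inner_self_eq_norm_sq, h1]
  have : s⁻¹ * (c * (c * (‖S.P a f‖ ^ 2 - ‖S.P (a + s / 2) f‖ ^ 2)))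
    = c ^ 2 * (((s / 2)⁻¹ * (‖S.P a f‖ ^ 2 - ‖S.P (a + s / 2) f‖ ^ 2)) / 2) := by
    field_simp
  rw [this]
  gcongr

theorem aux_l2 {E : Type*} [MeasurableSpace E] (μ : Measure E)
    (S : SymmSubMarkovSemigroup μ) (δ : ℝ) (hδ : 0 ≤ δ)
    (θ φ : ℝ → ℝ) (hθpos : ∀ r > 0, 0 < θ r)
    (hφ : ∀ t > 0, 0 < φ t ∧
      ∫⁻ s in Ioi (φ t), ENNReal.ofReal (1 / θ s) = ENNReal.ofReal t)
    (nash : ∀ f : Lp ℝ 2 μ, dirichletForm S f < ∞ → MemLp (f : E → ℝ) 1 μ →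
      eLpNorm (f : E → ℝ) 1 μ ≤ 1 → f ≠ 0 →
      ENNReal.ofReal (θ (‖f‖ ^ 2)) ≤ dirichletForm S f + ENNReal.ofReal (δ * ‖f‖ ^ 2))
    (T : ℝ) (hT : 0 < T) (f : Lp ℝ 2 μ) (hf : MemLp (f : E → ℝ) 1 μ)
    (hf1 : eLpNorm (f : E → ℝ) 1 μ ≤ 1) :
    ‖S.P T f‖ ^ 2 ≤ φ (2 * T) * Real.exp (2 * δ * T) := by
  set u : ℝ → ℝ := fun t => ‖S.P t f‖ ^ 2 with hu
  set v : ℝ → ℝ := fun t => Real.exp (-(2 * δ * t)) * u t with hv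
  suffices hmain : v T ≤ φ (2 * T) by
    have : u T = v T * Real.exp (2 * δ * T) := by
      simp only [hv]
      rw [mul_right_comm, ← Real.exp_add]; simp
    change u T ≤ _
    rw [this]
    gcongr
  by_contra! hlt
  obtain ⟨hφ0, hφi⟩ := hφ (2 * T) (by positivity)
  have hanti := aux_anti S f
  have vanti : AntitoneOn v (Ioi 0) := by
    intro a ha b hb hab
    have := hanti ha hb hab
    simp only [hv]
    gcongr
  -- a slightly larger time
  obtain ⟨T', hT', hvT'⟩ : ∃ T' > T, φ (2 * T) < v T' := by
    have h1 : Tendsto (fun s => v (T + s)) (nhdsWithin 0 (Ioi 0)) (nhds (v T)) := by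
      have h2 : Tendsto (fun s => ‖S.P s (S.P T f)‖ ^ 2) (nhdsWithin 0 (Ioi 0))
          (nhds (u T)) := ((S.strong_continuity (S.P T f)).norm).pow 2
      have h3 : Tendsto (fun s => Real.exp (-(2 * δ * (T + s)))) (nhdsWithin 0 (Ioi 0))
          (nhds (Real.exp (-(2 * δ * T)))) := by
        have : Continuous fun s => Real.exp (-(2 * δ * (T + s))) := by fun_prop
        have := (this.tendsto 0).mono_left (nhdsWithin_le_nhds (s := Ioi 0))
        simpa using this
      refine (h3.mul h2).congr' ?_
      filter_upwards [self_mem_nhdsWithin] with s hs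
      simp only [hv, hu]
      rw [← S.semigroup s hs T hT, add_comm T s]
    obtain ⟨s, hs1, hs2⟩ := ((h1.eventually (lt_mem_nhds hlt)).and self_mem_nhdsWithin).exists
    exact ⟨T + s, by simpa using hs2, hs1⟩
  have hT'0 : 0 < T' := hT.trans hT'
  set s : Set ℝ := Ioo 0 T' ∩ {t | DifferentiableAt ℝ u t} with hs
  have hsm : MeasurableSet s := measurableSet_Ioo.inter (measurableSet_of_differentiableAt ℝ u)
  set v' : ℝ → ℝ := fun t => Real.exp (-(2 * δ * t)) * (deriv u t - 2 * δ * u t) with hv'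
  have hder : ∀ t ∈ s, HasDerivAt v (v' t) t := by
    intro t ht
    have h1 : HasDerivAt u (deriv u t) t := ht.2.hasDerivAt
    have h2 : HasDerivAt (fun t => Real.exp (-(2 * δ * t)))
        (Real.exp (-(2 * δ * t)) * (-(2 * δ * 1))) t :=
      (((hasDerivAt_id t).const_mul (2 * δ)).neg).exp
    refine HasDerivAt.congr_deriv (h2.mul h1) ?_
    simp only [hv']; ring
  have hvpos : ∀ t ∈ s, φ (2 * T) < v t := fun t ht =>
    hvT'.trans_le (vanti ht.1.1 hT'0 ht.1.2.le)
  have hder2 : ∀ t ∈ s, 2 * θ (v t) ≤ - v' t := by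
    intro t ht
    have ht0 : 0 < t := ht.1.1
    set c := Real.exp (-(δ * t)) with hc
    have hc2 : c ^ 2 = Real.exp (-(2 * δ * t)) := by
      rw [hc, ← Real.exp_nat_mul]; congr 1; push_cast; ring
    have hc1 : c ≤ 1 := Real.exp_le_one_iff.2 (by have := mul_nonneg hδ ht0.le; linarith)
    have hc0 : 0 < c := Real.exp_pos _
    have hE := aux_dirichlet S f t (deriv u t) c ht0 ht.2.hasDerivAt
    have hn : ‖c • S.P t f‖ ^ 2 = v t := by
      rw [norm_smul, mul_pow, Real.norm_eq_abs, sq_abs, hc2]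
    have hne : c • S.P t f ≠ 0 := by
      intro h0
      rw [h0] at hn
      have := hvpos t ht
      simp at hn
      linarith
    have hPl1 := S.l1_contraction t ht0 f hf
    have hcoe := Lp.coeFn_smul c (S.P t f)
    have hl1 : eLpNorm (c • S.P t f : Lp ℝ 2 μ) 1 μ ≤ 1 := by
      rw [eLpNorm_congr_ae hcoe, eLpNorm_const_smul]
      calc _ ≤ (1 : ℝ≥0∞) * 1 := by
            gcongr
            · rw [Real.enorm_eq_ofReal hc0.le]; simpa using hc1
            · exact hPl1.trans hf1
        _ = 1 := one_mul _
    have hmem : MemLp (c • S.P t f : Lp ℝ 2 μ) 1 μ :=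
      ⟨Lp.aestronglyMeasurable _, hl1.trans_lt ENNReal.one_lt_top⟩
    have hN := nash (c • S.P t f) (hE.trans_lt ENNReal.ofReal_lt_top) hmem hl1 hne
    rw [hn] at hN
    have hD0 : 0 ≤ - deriv u t := by
      refine le_trans ?_ (aux_slope S f t 1 (deriv u t) ht0 one_pos ht.2.hasDerivAt)
      have := hanti (a := t) ht0 (b := t + 1) (by simp; linarith) (by linarith)
      simp only at this
      rw [inv_one, one_mul]; exact sub_nonneg.2 this
    have hv0 : 0 < v t := hφ0.trans (hvpos t ht)
    have hN2 := hN.trans (add_le_add_left hE _)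
    rw [← ENNReal.ofReal_add (by have := sq_nonneg c; apply mul_nonneg this; linarith)
      (mul_nonneg hδ hv0.le), ENNReal.ofReal_le_ofReal_iff (by
        have := mul_nonneg (sq_nonneg c) hD0
        have := mul_nonneg hδ hv0.le
        linarith)] at hN2
    have : - v' t = 2 * (c ^ 2 * (-deriv u t / 2) + δ * v t) := by
      simp only [hv', hv, hc2]; ring
    rw [this]; linarith
  have hinj' : ∀ a ∈ s, ∀ b ∈ s, a < b → v a ≠ v b := by
    intro a ha b hb hab h
    have hconst : ∀ x ∈ Icc a b, v x = v a := by
      intro x hx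
      have hx0 : 0 < x := ha.1.1.trans_le hx.1
      exact le_antisymm (vanti ha.1.1 hx0 hx.1) (h.trans_le (vanti hx0 hb.1.1 hx.2))
    have h1 : HasDerivWithinAt v (v' a) (Icc a b) a := (hder a ha).hasDerivWithinAt
    have h2 : HasDerivWithinAt v 0 (Icc a b) a :=
      (hasDerivWithinAt_const a (Icc a b) (v a)).congr hconst rfl
    have h3 := (uniqueDiffOn_Icc hab a (left_mem_Icc.2 hab.le)).eq_deriv _ h1 h2
    have h4 := hder2 a ha
    have := hθpos (v a) (hφ0.trans (hvpos a ha))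
    linarith
  have hinj : InjOn v s := by
    intro a ha b hb h
    rcases lt_trichotomy a b with hab | hab | hab
    · exact absurd h (hinj' a ha b hb hab)
    · exact hab
    · exact absurd h.symm (hinj' b hb a ha hab)
  have hvol : volume s = ENNReal.ofReal T' := by
    have h1 : ∀ᵐ x, x ∈ Ioo 0 T' → DifferentiableAt ℝ u x := by
      have h0 : MonotoneOn (fun t => - u t) (Ioi 0) := hanti.neg
      filter_upwards [h0.ae_differentiableWithinAt_of_mem] with x hx hx2
      have := ((hx hx2.1).differentiableAt (Ioi_mem_nhds hx2.1)).neg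
      simpa using this
    have h2 : s =ᵐ[volume] Ioo 0 T' := by
      filter_upwards [h1] with x hx
      refine propext ⟨fun h => h.1, fun h => ⟨h, hx h⟩⟩
    rw [measure_congr h2, Real.volume_Ioo, sub_zero]
  have hfin : ENNReal.ofReal (2 * T') ≤ ENNReal.ofReal (2 * T) := by
    rw [← hφi]
    calc ENNReal.ofReal (2 * T') = ∫⁻ x in s, ENNReal.ofReal 2 := by
          rw [setLIntegral_const, hvol, ENNReal.ofReal_mul (by norm_num)]
      _ ≤ ∫⁻ x in s, ENNReal.ofReal |v' x| * ENNReal.ofReal (1 / θ (v x)) := by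
          refine setLIntegral_mono' hsm fun x hx => ?_
          rw [← ENNReal.ofReal_mul (abs_nonneg _)]
          apply ENNReal.ofReal_le_ofReal
          have h1 := hθpos (v x) (hφ0.trans (hvpos x hx))
          rw [mul_one_div, le_div_iff₀ h1]
          exact (hder2 x hx).trans (neg_le_abs _)
      _ = ∫⁻ x in v '' s, ENNReal.ofReal (1 / θ x) :=
          (lintegral_image_eq_lintegral_abs_deriv_mul hsm
            (fun x hx => (hder x hx).hasDerivWithinAt) hinj
            (fun x => ENNReal.ofReal (1 / θ x))).symm
      _ ≤ _ := by
          apply lintegral_mono_set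
          rintro _ ⟨x, hx, rfl⟩
          exact hvpos x hx
  rw [ENNReal.ofReal_le_ofReal_iff (by positivity)] at hfin
  linarith

/-- (Nash-type inequality implies ultracontractivity.)
If `θ(‖f‖₂²) ≤ E(f,f) + δ‖f‖₂²` for every `f ∈ F ∩ L¹` with `‖f‖₁ ≤ 1`, `f ≠ 0`, where
`∫_1^∞ ds/θ(s) < ∞`, `∫_0^1 ds/θ(s) = ∞`, and `φ` is the inverse of `t ↦ ∫_t^∞ ds/θ(s)`,
then `‖P_t f‖_∞ ≤ φ(t) e^{δt} ‖f‖₁` for all `t > 0` and `f ∈ L¹ ∩ L²`. -/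
theorem statement9 {E : Type*} [MeasurableSpace E] (μ : Measure E) [SigmaFinite μ]
    (S : SymmSubMarkovSemigroup μ) (δ : ℝ) (hδ : 0 ≤ δ)
    (θ φ : ℝ → ℝ) (hθpos : ∀ r > 0, 0 < θ r)
    (hθint1 : ∫⁻ s in Ioi (1 : ℝ), ENNReal.ofReal (1 / θ s) < ∞)
    (hθint0 : ∫⁻ s in Ioo (0 : ℝ) 1, ENNReal.ofReal (1 / θ s) = ∞)
    (hφ : ∀ t > 0, 0 < φ t ∧
      ∫⁻ s in Ioi (φ t), ENNReal.ofReal (1 / θ s) = ENNReal.ofReal t)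
    (nash : ∀ f : Lp ℝ 2 μ, dirichletForm S f < ∞ → MemLp (f : E → ℝ) 1 μ →
      eLpNorm (f : E → ℝ) 1 μ ≤ 1 → f ≠ 0 →
      ENNReal.ofReal (θ (‖f‖ ^ 2)) ≤ dirichletForm S f + ENNReal.ofReal (δ * ‖f‖ ^ 2)) :
    ∀ t > 0, ∀ f : Lp ℝ 2 μ, MemLp (f : E → ℝ) 1 μ →
      eLpNorm (S.P t f : E → ℝ) ∞ μ ≤
        ENNReal.ofReal (φ t * Real.exp (δ * t)) * eLpNorm (f : E → ℝ) 1 μ := by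
  have hl2 : ∀ T > 0, ∀ f : Lp ℝ 2 μ, MemLp (f : E → ℝ) 1 μ →
      ‖S.P T f‖ ≤ √(φ (2 * T) * Real.exp (2 * δ * T)) * (eLpNorm (f : E → ℝ) 1 μ).toReal := by
    intro T hT f hf
    set K := (eLpNorm (f : E → ℝ) 1 μ).toReal with hK
    have hKe : eLpNorm (f : E → ℝ) 1 μ = ENNReal.ofReal K :=
      (ENNReal.ofReal_toReal hf.2.ne).symm
    have hK0 : 0 ≤ K := ENNReal.toReal_nonneg
    rcases hK0.eq_or_lt with h0 | h0
    · have : f = 0 := by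
        rw [← h0, ENNReal.ofReal_zero, eLpNorm_eq_zero_iff hf.1 one_ne_zero] at hKe
        exact (Lp.eq_zero_iff_ae_eq_zero).2 hKe
      rw [this]; simp [← h0]
    · have hcoe := Lp.coeFn_smul K⁻¹ f
      have hl1 : eLpNorm (K⁻¹ • f : Lp ℝ 2 μ) 1 μ ≤ 1 := by
        rw [eLpNorm_congr_ae hcoe, eLpNorm_const_smul, hKe,
          Real.enorm_eq_ofReal (by positivity), ← ENNReal.ofReal_mul (by positivity),
          inv_mul_cancel₀ h0.ne', ENNReal.ofReal_one]
      have hmem : MemLp (K⁻¹ • f : Lp ℝ 2 μ) 1 μ :=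
        ⟨Lp.aestronglyMeasurable _, hl1.trans_lt ENNReal.one_lt_top⟩
      have h := Real.le_sqrt_of_sq_le
        (aux_l2 μ S δ hδ θ φ hθpos hφ nash T hT (K⁻¹ • f) hmem hl1)
      rw [map_smul, norm_smul, Real.norm_eq_abs, abs_of_pos (by positivity),
        inv_mul_le_iff₀ h0] at h
      rw [mul_comm]; exact h
  intro t ht f hf
  set K := (eLpNorm (f : E → ℝ) 1 μ).toReal with hK
  have hKe : eLpNorm (f : E → ℝ) 1 μ = ENNReal.ofReal K :=
    (ENNReal.ofReal_toReal hf.2.ne).symm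
  set C := φ t * Real.exp (δ * t) with hC
  have hC0 : 0 ≤ C := mul_nonneg (hφ t ht).1.le (Real.exp_pos _).le
  have hbil : ∀ g : Lp ℝ 2 μ, MemLp (g : E → ℝ) 1 μ →
      |⟪g, S.P t f⟫| ≤ C * K * (eLpNorm (g : E → ℝ) 1 μ).toReal := by
    intro g hg
    have h2 : (0 : ℝ) < t / 2 := by positivity
    have e : S.P t f = S.P (t / 2) (S.P (t / 2) f) := by
      rw [← S.semigroup _ h2 _ h2, add_halves]
    rw [e, ← S.symm _ h2]
    refine (abs_real_inner_le_norm _ _).trans ?_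
    have hf2 := hl2 _ h2 f hf
    have hg2 := hl2 _ h2 g hg
    have e1 : φ (2 * (t / 2)) * Real.exp (2 * δ * (t / 2)) = C := by
      rw [hC]; congr 2 <;> ring_nf
    rw [e1] at hf2 hg2
    calc _ ≤ (√C * (eLpNorm (g : E → ℝ) 1 μ).toReal) * (√C * K) := by gcongr
      _ = (√C * √C) * K * (eLpNorm (g : E → ℝ) 1 μ).toReal := by ring
      _ = _ := by rw [Real.mul_self_sqrt hC0]
  have hint : Integrable (S.P t f : E → ℝ) μ :=
    memLp_one_iff_integrable.1 ⟨Lp.aestronglyMeasurable _,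
      (S.l1_contraction t ht f hf).trans_lt hf.2⟩
  have hset : ∀ s, MeasurableSet s → μ s < ∞ →
      |∫ x in s, (S.P t f : E → ℝ) x ∂μ| ≤ C * K * μ.real s := by
    intro s hs hμs
    have hn : eLpNorm (indicatorConstLp 2 hs hμs.ne (1 : ℝ) : Lp ℝ 2 μ) 1 μ = μ s := by
      rw [eLpNorm_congr_ae indicatorConstLp_coeFn, eLpNorm_indicator_const hs one_ne_zero
        ENNReal.one_ne_top]
      simp
    have := hbil (indicatorConstLp 2 hs hμs.ne (1 : ℝ))
      ⟨Lp.aestronglyMeasurable _, by rw [hn]; exact hμs⟩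
    rw [hn, L2.inner_indicatorConstLp_one] at this
    exact this
  have hup : 0 ≤ᵐ[μ] fun x => C * K - (S.P t f : E → ℝ) x := by
    apply ae_nonneg_of_forall_setIntegral_nonneg_of_sigmaFinite
    · intro s hs hμs
      exact (integrableOn_const hμs.ne).sub hint.integrableOn
    · intro s hs hμs
      have hci : Integrable (fun _ => C * K) (μ.restrict s) :=
        integrableOn_const (C := C * K) hμs.ne
      rw [integral_sub hci hint.integrableOn, setIntegral_const,
        smul_eq_mul]
      have := (abs_le.1 (hset s hs hμs)).2
      linarith
  have hlo : 0 ≤ᵐ[μ] fun x => C * K + (S.P t f : E → ℝ) x := by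
    apply ae_nonneg_of_forall_setIntegral_nonneg_of_sigmaFinite
    · intro s hs hμs
      exact (integrableOn_const hμs.ne).add hint.integrableOn
    · intro s hs hμs
      have hci : Integrable (fun _ => C * K) (μ.restrict s) :=
        integrableOn_const (C := C * K) hμs.ne
      rw [integral_add hci hint.integrableOn, setIntegral_const,
        smul_eq_mul]
      have := (abs_le.1 (hset s hs hμs)).1
      linarith
  rw [hKe, ← ENNReal.ofReal_mul hC0, eLpNorm_exponent_top]
  apply eLpNormEssSup_le_of_ae_bound
  filter_upwards [hup, hlo] with x h1 h2
  simp only [Pi.zero_apply] at h1 h2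
  rw [Real.norm_eq_abs, abs_le]
  constructor <;> linarith
end

section
/- Let (P_t)_{t>0} be a symmetric sub-Markovian semigroup on L²(μ) with associated Dirichlet form (E, F). Let δ ≥ 0 and let φ : (0,∞) → (0,∞) be a decreasing function such that ‖P_t f‖_∞ ≤ φ(t) e^{δ t} ‖f‖₁ for all t > 0 and all f ∈ L¹(μ) ∩ L²(μ). Define θ̃(r) := sup_{t>0} (r/t) log(r/φ(t)) for r > 0. Then θ̃(‖f‖₂²) ≤ E(f, f) + δ ‖f‖₂² for every f ∈ F ∩ L¹(μ) with ‖f‖₁ ≤ 1 and f ≠ 0. -/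
open MeasureTheory ENNReal Filter Set
open scoped RealInnerProductSpace

lemma aux_upper {E : Type*} [MeasurableSpace E] (μ : Measure E) (f g : Lp ℝ 2 μ) (C : ℝ)
    (hC : 0 ≤ C) (hf : MemLp (f : E → ℝ) 1 μ) (h1 : eLpNorm (f : E → ℝ) 1 μ ≤ 1)
    (hg : eLpNorm (g : E → ℝ) ∞ μ ≤ ENNReal.ofReal C * eLpNorm (f : E → ℝ) 1 μ) :
    ⟪g, f⟫ ≤ C := by
  have hg' : eLpNorm (g : E → ℝ) ∞ μ ≤ ENNReal.ofReal C :=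
    hg.trans (mul_le_of_le_one_right' h1)
  have hae : ∀ᵐ x ∂μ, ‖(g : E → ℝ) x‖ ≤ C := by
    rw [eLpNorm_exponent_top] at hg'
    filter_upwards [ae_le_eLpNormEssSup (f := (g : E → ℝ)) (μ := μ)] with x hx
    have := hx.trans hg'
    rw [← ofReal_norm_eq_enorm] at this
    exact (ENNReal.ofReal_le_ofReal_iff hC).1 this
  have hint : Integrable (f : E → ℝ) μ := memLp_one_iff_integrable.1 hf
  have hn : ∫ x, ‖(f : E → ℝ) x‖ ∂μ ≤ 1 := by
    rw [integral_norm_eq_lintegral_enorm hint.1, ← eLpNorm_one_eq_lintegral_enorm]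
    exact ENNReal.toReal_le_of_le_ofReal zero_le_one (by simpa using h1)
  rw [L2.inner_def]
  calc ∫ x, ⟪(g : E → ℝ) x, (f : E → ℝ) x⟫ ∂μ ≤ ∫ x, C * ‖(f : E → ℝ) x‖ ∂μ := by
        apply integral_mono_ae (L2.integrable_inner g f) (hint.norm.const_mul C)
        filter_upwards [hae] with x hx
        exact (real_inner_le_norm _ _).trans (mul_le_mul_of_nonneg_right hx (norm_nonneg _))
    _ = C * ∫ x, ‖(f : E → ℝ) x‖ ∂μ := integral_const_mul _ _
    _ ≤ C := mul_le_of_le_one_right hC hn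

lemma aux_lower {E : Type*} [MeasurableSpace E] (μ : Measure E)
    (S : SymmSubMarkovSemigroup μ) (f : Lp ℝ 2 μ) (hf : f ≠ 0) (K : ℝ)
    (hK : ∀ t > 0, t⁻¹ * ⟪f - S.P t f, f⟫ ≤ K) (t : ℝ) (ht : 0 < t) :
    Real.exp (-(t * K / ‖f‖ ^ 2)) ≤ ⟪S.P t f, f⟫ / ‖f‖ ^ 2 := by
  have ha : 0 < ‖f‖ ^ 2 := by
    have := norm_pos_iff.2 hf
    positivity
  set a := ‖f‖ ^ 2 with hadef
  have hsq : ∀ s > 0, ⟪S.P s f, f⟫ = ‖S.P (s / 2) f‖ ^ 2 := by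
    intro s hs
    have h2 : 0 < s / 2 := by positivity
    have : S.P s f = S.P (s / 2) (S.P (s / 2) f) := by
      rw [← S.semigroup _ h2 _ h2]; congr 2; ring
    rw [this, S.symm _ h2, real_inner_self_eq_norm_sq]
  have hstep : ∀ s > 0, (⟪S.P (s / 2) f, f⟫ / a) ^ 2 ≤ ⟪S.P s f, f⟫ / a := by
    intro s hs
    have h := abs_real_inner_le_norm (S.P (s / 2) f) f
    have h2 : ⟪S.P (s / 2) f, f⟫ ^ 2 ≤ ‖S.P (s / 2) f‖ ^ 2 * a := by
      rw [hadef, ← mul_pow, ← sq_abs]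
      exact pow_le_pow_left₀ (abs_nonneg _) h 2
    rw [hsq s hs, div_pow, div_le_div_iff₀ (by positivity) ha]
    nlinarith
  have hiter : ∀ n : ℕ, ∀ s > 0,
      (⟪S.P (s / 2 ^ n) f, f⟫ / a) ^ (2 ^ n) ≤ ⟪S.P s f, f⟫ / a := by
    intro n
    induction n with
    | zero => intro s hs; simp
    | succ n ih =>
      intro s hs
      refine le_trans ?_ (ih s hs)
      have h := hstep (s / 2 ^ n) (by positivity)
      rw [pow_succ' (2 : ℝ) n, pow_succ' (2 : ℕ) n, pow_mul]
      have e : s / (2 * 2 ^ n) = s / 2 ^ n / 2 := by field_simp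
      rw [e]
      exact pow_le_pow_left₀ (sq_nonneg _) h _
  have hlim : Tendsto (fun n : ℕ => (1 + (-(t * K / a)) / ((2 ^ n : ℕ) : ℝ)) ^ (2 ^ n)) atTop
      (nhds (Real.exp (-(t * K / a)))) :=
    (Real.tendsto_one_add_div_pow_exp (-(t * K / a))).comp
      (tendsto_pow_atTop_atTop_of_one_lt (by norm_num : 1 < 2))
  have hlim0 : Tendsto (fun n : ℕ => 1 + (-(t * K / a)) / ((2 ^ n : ℕ) : ℝ)) atTop
      (nhds (1 + 0)) :=
    tendsto_const_nhds.add ((tendsto_const_div_atTop_nhds_zero_nat _).comp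
      (tendsto_pow_atTop_atTop_of_one_lt (by norm_num : 1 < 2)))
  refine le_of_tendsto hlim ?_
  filter_upwards [hlim0.eventually (lt_mem_nhds (by norm_num : (0 : ℝ) < 1 + 0))] with n hn
  refine le_trans (pow_le_pow_left₀ hn.le ?_ _) (hiter n t ht)
  have hs : 0 < t / 2 ^ n := by positivity
  have h := hK _ hs
  rw [inner_sub_left, real_inner_self_eq_norm_sq, ← hadef, inv_mul_le_iff₀ hs] at h
  rw [le_div_iff₀ ha]
  have e : (1 + (-(t * K / a)) / ((2 ^ n : ℕ) : ℝ)) * a = a - t / 2 ^ n * K := by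
    push_cast
    field_simp
    ring
  rw [e]; linarith

/-- (Ultracontractivity implies a generalized Nash-type inequality.)
If `φ : (0,∞) → (0,∞)` is decreasing and `‖P_t f‖_∞ ≤ φ(t) e^{δt} ‖f‖₁` for all `t > 0`
and `f ∈ L¹ ∩ L²`, then with `θ̃(r) = sup_{t>0} (r/t) log(r/φ(t))` (supremum in `[0,∞]`),
`θ̃(‖f‖₂²) ≤ E(f,f) + δ‖f‖₂²` for every `f ∈ F ∩ L¹` with `‖f‖₁ ≤ 1` and `f ≠ 0`. -/
theorem statement10 {E : Type*} [MeasurableSpace E] (μ : Measure E) [SigmaFinite μ]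
    (S : SymmSubMarkovSemigroup μ) (δ : ℝ) (hδ : 0 ≤ δ)
    (φ : ℝ → ℝ) (hφpos : ∀ t > 0, 0 < φ t) (hφdec : AntitoneOn φ (Ioi 0))
    (hultra : ∀ t > 0, ∀ f : Lp ℝ 2 μ, MemLp (f : E → ℝ) 1 μ →
      eLpNorm (S.P t f : E → ℝ) ∞ μ ≤
        ENNReal.ofReal (φ t * Real.exp (δ * t)) * eLpNorm (f : E → ℝ) 1 μ) :
    ∀ f : Lp ℝ 2 μ, dirichletForm S f < ∞ → MemLp (f : E → ℝ) 1 μ →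
      eLpNorm (f : E → ℝ) 1 μ ≤ 1 → f ≠ 0 →
      (⨆ t : {t : ℝ // 0 < t},
          ENNReal.ofReal ((‖f‖ ^ 2 / t) * Real.log (‖f‖ ^ 2 / φ t))) ≤
        dirichletForm S f + ENNReal.ofReal (δ * ‖f‖ ^ 2) := by
  intro f hfin hf1 hle hf0
  have ha : 0 < ‖f‖ ^ 2 := by
    have := norm_pos_iff.2 hf0
    positivity
  have hK : ∀ t > 0, t⁻¹ * ⟪f - S.P t f, f⟫ ≤ (dirichletForm S f).toReal := by
    intro t ht
    refine (ENNReal.ofReal_le_iff_le_toReal hfin.ne).1 ?_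
    exact le_iSup (fun t : {t : ℝ // 0 < t} =>
      ENNReal.ofReal ((t : ℝ)⁻¹ * ⟪f - S.P t f, f⟫)) ⟨t, ht⟩
  refine iSup_le ?_
  rintro ⟨t, ht⟩
  have hp := hφpos t ht
  have hu := aux_upper μ f (S.P t f) (φ t * Real.exp (δ * t)) (by positivity) hf1 hle
    (hultra t ht f hf1)
  have hl := aux_lower μ S f hf0 _ hK t ht
  rw [← ENNReal.ofReal_toReal hfin.ne, ← ENNReal.ofReal_add ENNReal.toReal_nonneg (by positivity)]
  apply ENNReal.ofReal_le_ofReal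
  set K := (dirichletForm S f).toReal
  set a := ‖f‖ ^ 2
  have h1 : Real.exp (-(t * K / a)) ≤ φ t * Real.exp (δ * t) / a :=
    hl.trans (div_le_div_of_nonneg_right hu ha.le)
  have h2 : a / φ t ≤ Real.exp (δ * t + t * K / a) := by
    rw [Real.exp_neg, le_div_iff₀ ha, inv_mul_le_iff₀ (Real.exp_pos _)] at h1
    rw [div_le_iff₀ hp, Real.exp_add]
    linarith
  have h3 : Real.log (a / φ t) ≤ δ * t + t * K / a :=
    (Real.log_le_iff_le_exp (by positivity)).2 h2
  calc a / t * Real.log (a / φ t) ≤ a / t * (δ * t + t * K / a) := by gcongr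
    _ = K + δ * a := by field_simp; ring
end

section
/- Let (P_t)_{t>0} be a symmetric sub-Markovian semigroup on L²(μ) with associated Dirichlet form (E, F), and let δ ≥ 0. Let φ be a strictly decreasing differentiable bijection of (0,∞) onto (0,∞) satisfying condition (D), and set θ(r) := −φ'(φ⁻¹(r)) for r > 0. Then the following are equivalent: (i) there is a constant c₁ > 0 such that ‖P_t f‖_∞ ≤ φ(c₁ t) e^{δ t} ‖f‖₁ for all t > 0 and all f ∈ L¹(μ) ∩ L²(μ); (ii) there is a constant c₂ > 0 such that c₂ θ(‖f‖₂²) ≤ E(f, f) + δ ‖f‖₂² for every f ∈ F ∩ L¹(μ) with ‖f‖₁ ≤ 1 and f ≠ 0. -/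
open MeasureTheory ENNReal Filter Set
open scoped RealInnerProductSpace

lemma aux_midpoint_convex (g : ℝ → ℝ) (hc : ContinuousOn g (Ioi 0))
    (hm : ∀ a > 0, ∀ b > 0, g ((a + b) / 2) ≤ (g a + g b) / 2) : ConvexOn ℝ (Ioi 0) g := by
  refine LinearOrder.convexOn_of_lt (convex_Ioi 0) ?_
  intro x hx z hz hxz a b ha hb hab
  simp only [smul_eq_mul]
  have hx0 : (0 : ℝ) < x := hx
  set y := a * x + b * z with hy
  have hyx : y - x = b * (z - x) := by rw [hy]; linear_combination x * hab
  have hzy : z - y = a * (z - x) := by rw [hy]; linear_combination - z * hab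
  have hzx : 0 < z - x := sub_pos.2 hxz
  have hxy : x < y := by have := mul_pos hb hzx; linarith
  have hyz : y < z := by have := mul_pos ha hzx; linarith
  set q := (g z - g x) / (z - x) with hq
  have hq' : q * (z - x) = g z - g x := div_mul_cancel₀ _ hzx.ne'
  -- perturbed function
  have key : ∀ e > 0, g y - (g x + q * (y - x)) + e * ((y - x) * (y - z)) ≤ 0 := by
    intro e he
    set k : ℝ → ℝ := fun u => g u - (g x + q * (u - x)) + e * ((u - x) * (u - z)) with hk
    have hkc : ContinuousOn k (Icc x z) := by
      have : ContinuousOn g (Icc x z) := hc.mono fun u hu => lt_of_lt_of_le hx0 hu.1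
      fun_prop
    obtain ⟨u, hu, hmax⟩ := isCompact_Icc.exists_isMaxOn (nonempty_Icc.2 hxz.le) hkc
    have hmax' : ∀ v ∈ Icc x z, k v ≤ k u := fun v hv => hmax hv
    have hku : k u ≤ 0 := by
      rcases eq_or_lt_of_le hu.1 with h1 | h1
      · rw [← h1]; simp [hk]
      rcases eq_or_lt_of_le hu.2 with h2 | h2
      · rw [h2]; simp [hk]; linarith
      exfalso
      set h := min (u - x) (z - u) with hh
      have hpos : 0 < h := lt_min (by linarith) (by linarith)
      have hl1 : h ≤ u - x := min_le_left _ _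
      have hl2 : h ≤ z - u := min_le_right _ _
      have m1 := hmax' (u - h) ⟨by linarith, by linarith⟩
      have m2 := hmax' (u + h) ⟨by linarith, by linarith⟩
      have m3 := hm (u - h) (by linarith) (u + h) (by linarith)
      have e1 : (u - h + (u + h)) / 2 = u := by ring
      rw [e1] at m3
      simp only [hk] at m1 m2
      have : 0 < e * h ^ 2 := by positivity
      nlinarith
    exact (hmax' y ⟨hxy.le, hyz.le⟩).trans hku
  have h0 : g y - (g x + q * (y - x)) ≤ 0 := by
    refine le_of_forall_pos_le_add fun r hr => ?_
    have hp : 0 < (y - x) * (z - y) := mul_pos (by linarith) (by linarith)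
    have := key (r / ((y - x) * (z - y))) (by positivity)
    have e2 : r / ((y - x) * (z - y)) * ((y - x) * (y - z)) = -r := by
      have : (y - x) * (y - z) = -((y - x) * (z - y)) := by ring
      rw [this, mul_neg, div_mul_cancel₀ _ hp.ne']
    linarith
  have : q * (y - x) = b * (g z - g x) := by rw [hyx, ← hq']; ring
  have : a = 1 - b := by linarith
  subst this
  linarith

lemma aux_exp (r : ℝ → ℝ) (a : ℝ) (h0 : ∀ s > 0, 0 ≤ r s)
    (h1 : ∀ s > 0, r (s / 2) ^ 2 ≤ r s) (h2 : ∀ s > 0, 1 - s * a ≤ r s) :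
    ∀ t > 0, Real.exp (-(t * a)) ≤ r t := by
  intro t ht
  have hind : ∀ n : ℕ, r (t / 2 ^ n) ^ (2 ^ n) ≤ r t := by
    intro n
    induction n with
    | zero => simp
    | succ n ih =>
      refine le_trans ?_ ih
      have hp : 0 < t / 2 ^ n := by positivity
      have e : t / 2 ^ (n + 1) = t / 2 ^ n / 2 := by rw [pow_succ, div_div]
      rw [e, pow_succ, mul_comm, pow_mul]
      exact pow_le_pow_left₀ (sq_nonneg _) (h1 _ hp) _
  have hN : Tendsto (fun n : ℕ => 2 ^ n) atTop (atTop : Filter ℕ) :=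
    tendsto_pow_atTop_atTop_of_one_lt (by norm_num)
  have hlim := (Real.tendsto_one_add_div_pow_exp (-(t * a))).comp hN
  refine le_of_tendsto hlim ?_
  have hz : Tendsto (fun n : ℕ => 1 + -(t * a) / ((2 ^ n : ℕ) : ℝ)) atTop (nhds (1 + 0)) := by
    refine tendsto_const_nhds.add ?_
    exact (tendsto_const_nhds.div_atTop tendsto_natCast_atTop_atTop).comp hN
  have hev : ∀ᶠ n : ℕ in atTop, 0 < 1 + -(t * a) / ((2 ^ n : ℕ) : ℝ) :=
    hz.eventually (lt_mem_nhds (by norm_num))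
  filter_upwards [hev] with n hn
  refine le_trans ?_ (hind n)
  simp only [Function.comp]
  refine pow_le_pow_left₀ hn.le ?_ _
  have := h2 (t / 2 ^ n) (by positivity)
  refine le_trans (le_of_eq ?_) this
  push_cast
  ring

section
variable {E : Type*} [MeasurableSpace E] {μ : Measure E} (S : SymmSubMarkovSemigroup μ)

lemma aux_g_add (f : Lp ℝ 2 μ) {s t : ℝ} (hs : 0 < s) (ht : 0 < t) :
    ⟪S.P (s + t) f, f⟫ = ⟪S.P s f, S.P t f⟫ := by
  rw [add_comm, S.semigroup t ht s hs, S.symm t ht]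

lemma aux_g_two (f : Lp ℝ 2 μ) {s : ℝ} (hs : 0 < s) :
    ⟪S.P (2 * s) f, f⟫ = ‖S.P s f‖ ^ 2 := by
  rw [two_mul, aux_g_add S f hs hs, real_inner_self_eq_norm_sq]

lemma aux_g_nonneg (f : Lp ℝ 2 μ) {s : ℝ} (hs : 0 < s) : 0 ≤ ⟪S.P s f, f⟫ := by
  have := aux_g_two S f (half_pos hs)
  rw [mul_div_cancel₀ _ (two_ne_zero)] at this
  rw [this]; positivity

lemma aux_g_half (f : Lp ℝ 2 μ) {s : ℝ} (hs : 0 < s) :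
    ⟪S.P (s / 2) f, f⟫ ^ 2 ≤ ⟪S.P s f, f⟫ * ‖f‖ ^ 2 := by
  have := aux_g_two S f (half_pos hs)
  rw [mul_div_cancel₀ _ (two_ne_zero)] at this
  rw [this, ← mul_pow]
  exact pow_le_pow_left₀ (aux_g_nonneg S f (half_pos hs)) (real_inner_le_norm _ _) 2

lemma aux_g_cont (f : Lp ℝ 2 μ) : ContinuousOn (fun t => ⟪S.P t f, f⟫) (Ioi 0) := by
  have hd : ∀ a > 0, ∀ h > 0, |⟪S.P (a + h) f, f⟫ - ⟪S.P a f, f⟫| ≤ ‖S.P h f - f‖ * ‖f‖ := by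
    intro a ha h hh
    rw [S.semigroup a ha h hh, ← inner_sub_left, ← map_sub]
    refine (abs_real_inner_le_norm _ _).trans ?_
    gcongr
    exact S.l2_contraction a ha _
  have hlim : Tendsto (fun h => ‖S.P h f - f‖ * ‖f‖) (nhdsWithin 0 (Ioi 0)) (nhds 0) := by
    have h1 := ((S.strong_continuity f).sub_const f).norm.mul_const ‖f‖
    simpa using h1
  rw [Metric.continuousOn_iff]
  intro a ha e he
  have hev := hlim.eventually (gt_mem_nhds he)
  rw [eventually_nhdsWithin_iff, Metric.eventually_nhds_iff] at hev
  obtain ⟨η, hη, H⟩ := hev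
  refine ⟨η, hη, fun b hb hab => ?_⟩
  rw [Real.dist_eq] at hab ⊢
  rcases lt_trichotomy a b with h | h | h
  · have := hd a ha (b - a) (sub_pos.2 h)
    rw [add_sub_cancel] at this
    refine this.trans_lt (H ?_ (sub_pos.2 h))
    rw [Real.dist_eq, sub_zero]; exact hab
  · subst h; simpa using he
  · have := hd b hb (a - b) (sub_pos.2 h)
    rw [add_sub_cancel, abs_sub_comm] at this
    refine this.trans_lt (H ?_ (sub_pos.2 h))
    rw [Real.dist_eq, sub_zero, abs_sub_comm]; exact hab

lemma aux_g_convex (f : Lp ℝ 2 μ) : ConvexOn ℝ (Ioi 0) (fun t => ⟪S.P t f, f⟫) := by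
  refine aux_midpoint_convex _ (aux_g_cont S f) fun a ha b hb => ?_
  have e : (a + b) / 2 = a / 2 + b / 2 := by ring
  have ea := aux_g_two S f (half_pos ha)
  have eb := aux_g_two S f (half_pos hb)
  rw [mul_div_cancel₀ _ (two_ne_zero)] at ea eb
  rw [e, aux_g_add S f (half_pos ha) (half_pos hb), ea, eb]
  have := real_inner_le_norm (S.P (a / 2) f) (S.P (b / 2) f)
  nlinarith [sq_nonneg (‖S.P (a / 2) f‖ - ‖S.P (b / 2) f‖)]

/-- the pairing bound -/
lemma aux_pair (F f : Lp ℝ 2 μ) (C : ℝ) (hC : 0 ≤ C) (hf : MemLp (f : E → ℝ) 1 μ)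
    (hf1 : eLpNorm (f : E → ℝ) 1 μ ≤ 1) (hF : eLpNorm (F : E → ℝ) ∞ μ ≤ ENNReal.ofReal C) :
    ⟪F, f⟫ ≤ C := by
  have hb : ∀ᵐ x ∂μ, |F x| ≤ C := by
    rw [eLpNorm_exponent_top] at hF
    filter_upwards [enorm_ae_le_eLpNormEssSup (F : E → ℝ) μ] with x hx
    have := hx.trans hF
    rw [Real.enorm_eq_ofReal_abs] at this
    exact (ENNReal.ofReal_le_ofReal_iff hC).1 this
  have hfi : Integrable (f : E → ℝ) μ := memLp_one_iff_integrable.1 hf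
  have hn : ∫ x, ‖f x‖ ∂μ ≤ 1 := by
    rw [integral_norm_eq_lintegral_enorm hfi.1, ← eLpNorm_one_eq_lintegral_enorm]
    exact ENNReal.toReal_le_of_le_ofReal zero_le_one (by simpa using hf1)
  rw [L2.inner_def]
  calc ∫ x, ⟪F x, f x⟫ ∂μ ≤ ∫ x, C * ‖f x‖ ∂μ := by
        refine integral_mono_ae (L2.integrable_inner F f) (hfi.norm.const_mul C) ?_
        filter_upwards [hb] with x hx
        refine (real_inner_le_norm _ _).trans ?_
        exact mul_le_mul_of_nonneg_right hx (norm_nonneg _)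
    _ = C * ∫ x, ‖f x‖ ∂μ := integral_const_mul _ _
    _ ≤ C * 1 := by gcongr
    _ = C := mul_one C

/-- the dual statement -/
lemma aux_dual [SigmaFinite μ] (F : Lp ℝ 2 μ) (C : ℝ) (hC : 0 ≤ C)
    (h : ∀ f : Lp ℝ 2 μ, MemLp (f : E → ℝ) 1 μ →
      |⟪f, F⟫| ≤ C * (eLpNorm (f : E → ℝ) 1 μ).toReal) :
    eLpNorm (F : E → ℝ) ∞ μ ≤ ENNReal.ofReal C := by
  have hint : ∀ s, MeasurableSet s → μ s < ∞ → IntegrableOn (F : E → ℝ) s μ := fun s _ hμ =>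
    integrableOn_Lp_of_measure_ne_top F fact_one_le_two_ennreal.elim hμ.ne
  have hset : ∀ s, MeasurableSet s → μ s < ∞ → |∫ x in s, F x ∂μ| ≤ C * (μ s).toReal := by
    intro s hs hμ
    have hco := @indicatorConstLp_coeFn _ _ _ 2 μ _ s hs hμ.ne (1 : ℝ)
    have hm : MemLp (s.indicator fun _ => (1 : ℝ)) 1 μ :=
      memLp_indicator_const 1 hs 1 (Or.inr hμ.ne)
    have := h (indicatorConstLp 2 hs hμ.ne (1 : ℝ)) (hm.ae_eq hco.symm)
    rw [L2.inner_indicatorConstLp_one, eLpNorm_congr_ae hco,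
      eLpNorm_indicator_const hs one_ne_zero one_ne_top] at this
    simpa using this
  have hCi : ∀ s, μ s < ∞ → IntegrableOn (fun _ : E => C) s μ := fun s hμ =>
    integrableOn_const hμ.ne
  have h1 : 0 ≤ᵐ[μ] fun x => C - F x := by
    refine ae_nonneg_of_forall_setIntegral_nonneg_of_sigmaFinite
      (fun s hs hμ => (hCi s hμ).sub (hint s hs hμ)) fun s hs hμ => ?_
    rw [integral_sub (hCi s hμ) (hint s hs hμ), setIntegral_const, smul_eq_mul]
    have := (abs_le.1 (hset s hs hμ)).2
    rw [measureReal_def]; linarith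
  have h2 : 0 ≤ᵐ[μ] fun x => C + F x := by
    refine ae_nonneg_of_forall_setIntegral_nonneg_of_sigmaFinite
      (fun s hs hμ => (hCi s hμ).add (hint s hs hμ)) fun s hs hμ => ?_
    rw [integral_add (hCi s hμ) (hint s hs hμ), setIntegral_const, smul_eq_mul]
    have := (abs_le.1 (hset s hs hμ)).1
    rw [measureReal_def]; linarith
  rw [eLpNorm_exponent_top]
  refine eLpNormEssSup_le_of_ae_bound ?_
  filter_upwards [h1, h2] with x a b
  simp only [Pi.zero_apply] at a b
  rw [Real.norm_eq_abs, abs_le]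
  constructor <;> linarith

end

section
variable {E : Type*} [MeasurableSpace E] {μ : Measure E} (S : SymmSubMarkovSemigroup μ)

lemma aux_deriv_log (φ : ℝ → ℝ) (hφpos : ∀ r > 0, 0 < φ r)
    (hφdiff : ∀ r > 0, DifferentiableAt ℝ φ r) {t : ℝ} (ht : 0 < t) :
    HasDerivAt (fun u => -Real.log (φ u)) (-(deriv φ t / φ t)) t :=
  (((hφdiff t ht).hasDerivAt).log (hφpos t ht).ne').neg

lemma aux_deriv_neg (φ : ℝ → ℝ)
    (hφpos : ∀ r > 0, 0 < φ r) (hφanti : StrictAntiOn φ (Ioi 0))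
    (hφdiff : ∀ r > 0, DifferentiableAt ℝ φ r)
    (lam : ℝ) (hlam : 0 < lam) (hD : ∀ t > 0, ∀ s ∈ Icc t (2 * t),
      lam * deriv (fun u => -Real.log (φ u)) t ≤ deriv (fun u => -Real.log (φ u)) s) :
    ∀ r > 0, deriv φ r < 0 := by
  intro r hr
  by_contra hcon
  push Not at hcon
  have hM0 : deriv (fun u => -Real.log (φ u)) r ≤ 0 := by
    rw [(aux_deriv_log φ hφpos hφdiff hr).deriv]
    have := div_nonneg hcon (hφpos r hr).le
    linarith
  have hr2 : r / 2 < r := by linarith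
  obtain ⟨x, hx, hx'⟩ := exists_deriv_eq_slope φ hr2
    (fun u hu => (hφdiff u (by have := hu.1; linarith)).continuousAt.continuousWithinAt)
    (fun u hu => (hφdiff u (by have := hu.1; linarith)).differentiableWithinAt)
  have hx0 : 0 < x := by have := hx.1; linarith
  have h1 := hD x hx0 r ⟨hx.2.le, by have := hx.1; linarith⟩
  have hlt : φ r < φ (r / 2) := hφanti (half_pos hr) hr hr2
  have hneg : deriv φ x < 0 := by
    rw [hx']
    exact div_neg_of_neg_of_pos (by linarith) (by linarith)
  rw [(aux_deriv_log φ hφpos hφdiff hx0).deriv] at h1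
  have := div_neg_of_neg_of_pos hneg (hφpos x hx0)
  have : 0 < lam * -(deriv φ x / φ x) := mul_pos hlam (by linarith)
  linarith

lemma aux_core (δ : ℝ) (hδ : 0 ≤ δ)
    (φ φinv : ℝ → ℝ)
    (hφpos : ∀ r > 0, 0 < φ r) (hφanti : StrictAntiOn φ (Ioi 0))
    (hφdiff : ∀ r > 0, DifferentiableAt ℝ φ r)
    (hinv_pos : ∀ r > 0, 0 < φinv r)
    (hinv_left : ∀ r > 0, φinv (φ r) = r)
    (hinv_right : ∀ r > 0, φ (φinv r) = r)
    (hneg : ∀ r > 0, deriv φ r < 0) (c₂ : ℝ) (hc₂ : 0 < c₂)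
    (hN : ∀ f : Lp ℝ 2 μ, dirichletForm S f < ∞ → MemLp (f : E → ℝ) 1 μ →
        eLpNorm (f : E → ℝ) 1 μ ≤ 1 → f ≠ 0 →
        ENNReal.ofReal (c₂ * -deriv φ (φinv (‖f‖ ^ 2))) ≤
          dirichletForm S f + ENNReal.ofReal (δ * ‖f‖ ^ 2))
    (f : Lp ℝ 2 μ) (hf : MemLp (f : E → ℝ) 1 μ) (hf1 : eLpNorm (f : E → ℝ) 1 μ ≤ 1)
    (t : ℝ) (ht : 0 < t) :
    ‖S.P t f‖ ^ 2 ≤ Real.exp (2 * δ * t) * φ (c₂ / 2 * t) := by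
  set g : ℝ → ℝ := fun u => ⟪S.P u f, f⟫ with hg
  have hconv : ConvexOn ℝ (Ioi 0) g := aux_g_convex S f
  have hcont : ContinuousOn g (Ioi 0) := aux_g_cont S f
  set D : ℝ → ℝ := fun s => derivWithin g (Ioi (2 * s)) (2 * s) with hDdef
  have hDd : ∀ s > 0, HasDerivWithinAt g (D s) (Ici (2 * s)) (2 * s) := by
    intro s hs
    refine hasDerivWithinAt_Ioi_iff_Ici.1 ?_
    refine hconv.hasDerivWithinAt_rightDeriv_of_mem_interior ?_
    rw [interior_Ioi]; exact mul_pos two_pos hs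
  have hDs : ∀ s > 0, ∀ τ > 0, D s ≤ (g (2 * s + τ) - g (2 * s)) / τ := by
    intro s hs τ hτ
    have hm : (2 * s) ∈ interior (Ioi (0 : ℝ)) := by
      rw [interior_Ioi]; exact mul_pos two_pos hs
    have := hconv.rightDeriv_le_slope_of_mem_interior hm
      (y := 2 * s + τ) (by rw [mem_Ioi]; positivity) (by linarith)
    rwa [slope_def_field, add_sub_cancel_left] at this
  have hDn : ∀ s > 0, D s ≤ 0 := by
    intro s hs
    refine (hDs s hs 2 two_pos).trans ?_
    have e : 2 * s + 2 = 2 * (1 + s) := by ring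
    have h1 : g (2 * s + 2) = ‖S.P (1 + s) f‖ ^ 2 := by
      rw [e]; exact aux_g_two S f (by linarith)
    have h2 : g (2 * s) = ‖S.P s f‖ ^ 2 := aux_g_two S f hs
    rw [h1, h2, S.semigroup 1 one_pos s hs]
    have := pow_le_pow_left₀ (norm_nonneg _) (S.l2_contraction 1 one_pos (S.P s f)) 2
    exact div_nonpos_of_nonpos_of_nonneg (by linarith) (by norm_num)
  set v : ℝ → ℝ := fun s => Real.exp (-(2 * δ) * s) * g (2 * s) with hv
  set v' : ℝ → ℝ := fun s => (Real.exp (-(2 * δ) * s) * (-(2 * δ) * 1)) * g (2 * s) +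
    Real.exp (-(2 * δ) * s) * (D s * (2 * 1)) with hv'
  have hvd : ∀ s > 0, HasDerivWithinAt v (v' s) (Ici s) s := by
    intro s hs
    have h1 : HasDerivWithinAt (fun s => Real.exp (-(2 * δ) * s))
        (Real.exp (-(2 * δ) * s) * (-(2 * δ) * 1)) (Ici s) s :=
      (((hasDerivAt_id s).const_mul (-(2 * δ))).exp).hasDerivWithinAt
    have h2 : HasDerivWithinAt (fun s : ℝ => 2 * s) (2 * 1) (Ici s) s :=
      ((hasDerivAt_id s).const_mul 2).hasDerivWithinAt
    have h3 : HasDerivWithinAt (fun s => g (2 * s)) (D s * (2 * 1)) (Ici s) s :=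
      HasDerivWithinAt.comp s (hDd s hs) h2 (fun u (hu : s ≤ u) => by
        simp only [mem_Ici]; linarith)
    exact h1.mul h3
  have hvn : ∀ s > 0, v s = Real.exp (-(2 * δ) * s) * ‖S.P s f‖ ^ 2 := by
    intro s hs
    simp only [hv, hg]
    rw [aux_g_two S f hs]
  have hvnn : ∀ s > 0, 0 ≤ v s := by
    intro s hs; rw [hvn s hs]; positivity
  have hvc : ContinuousOn v (Icc (t / 2) t) := by
    have : ContinuousOn (fun s => g (2 * s)) (Icc (t / 2) t) := by
      refine hcont.comp (by fun_prop) fun u hu => ?_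
      have := hu.1
      simp only [mem_Ioi]; linarith
    refine ContinuousOn.mul (by fun_prop) this
  set a := φinv (v (t / 2) + 1) with ha
  have hv1 : 0 < v (t / 2) + 1 := by have := hvnn (t / 2) (half_pos ht); linarith
  have ha0 : 0 < a := hinv_pos _ hv1
  have haφ : φ a = v (t / 2) + 1 := hinv_right _ hv1
  set B : ℝ → ℝ := fun s => φ (a + c₂ * (s - t / 2)) with hB
  set B' : ℝ → ℝ := fun s => deriv φ (a + c₂ * (s - t / 2)) * (c₂ * 1) with hB'
  have hypos : ∀ s, t / 2 ≤ s → 0 < a + c₂ * (s - t / 2) := by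
    intro s hs
    have := mul_nonneg hc₂.le (sub_nonneg.2 hs)
    linarith
  have hBd : ∀ s, t / 2 ≤ s → HasDerivAt B (B' s) s := by
    intro s hs
    have h2 : HasDerivAt (fun s : ℝ => a + c₂ * (s - t / 2)) (c₂ * 1) s :=
      (((hasDerivAt_id s).sub_const (t / 2)).const_mul c₂).const_add a
    exact HasDerivAt.comp s (hφdiff _ (hypos s hs)).hasDerivAt h2
  have hfin : v t ≤ B t := by
    refine image_le_of_deriv_right_lt_deriv_boundary' (a := t / 2) (b := t) hvc
      (fun x hx => hvd x (by have := hx.1; linarith)) (B := B) (B' := B') ?_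
      (fun x hx => (hBd x hx.1).continuousAt.continuousWithinAt)
      (fun x hx => (hBd x hx.1).hasDerivWithinAt) ?_ ⟨by linarith, le_rfl⟩
    · simp only [hB, sub_self, mul_zero, add_zero, haφ]; linarith
    intro x hx hvB
    have hx0 : 0 < x := by have := hx.1; linarith
    set y := a + c₂ * (x - t / 2) with hy
    have hy0 : 0 < y := hypos x hx.1
    have hvφ : v x = φ y := hvB
    set h : Lp ℝ 2 μ := Real.exp (-δ * x) • S.P x f with hh
    have hexp : Real.exp (-δ * x) ^ 2 = Real.exp (-(2 * δ) * x) := by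
      rw [← Real.exp_nat_mul]; congr 1; push_cast; ring
    have hhn : ‖h‖ ^ 2 = v x := by
      rw [hh, norm_smul, mul_pow, hvn x hx0, Real.norm_eq_abs, sq_abs, hexp]
    have hh0 : h ≠ 0 := by
      intro h0
      rw [h0] at hhn
      have := hφpos y hy0
      simp at hhn
      linarith
    have hco : (h : E → ℝ) =ᵐ[μ] Real.exp (-δ * x) • (S.P x f : E → ℝ) := Lp.coeFn_smul _ _
    have hl1 : eLpNorm (h : E → ℝ) 1 μ ≤ 1 := by
      rw [eLpNorm_congr_ae hco, eLpNorm_const_smul]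
      have e1 : ‖Real.exp (-δ * x)‖ₑ ≤ 1 := by
        rw [Real.enorm_eq_ofReal (Real.exp_pos _).le]
        refine ENNReal.ofReal_le_one.2 (Real.exp_le_one_iff.2 ?_)
        have := mul_nonneg hδ hx0.le
        linarith
      calc _ ≤ (1 : ℝ≥0∞) * 1 :=
            mul_le_mul' e1 ((S.l1_contraction x hx0 f hf).trans hf1)
        _ = 1 := one_mul 1
    have hm : MemLp (h : E → ℝ) 1 μ :=
      ⟨(Lp.aestronglyMeasurable h), hl1.trans_lt ENNReal.one_lt_top⟩
    have hE : dirichletForm S h ≤ ENNReal.ofReal (-(Real.exp (-(2 * δ) * x) * D x)) := by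
      refine iSup_le fun τ => ENNReal.ofReal_le_ofReal ?_
      obtain ⟨τ, hτ⟩ := τ
      have e1 : ⟪h - S.P τ h, h⟫ = Real.exp (-(2 * δ) * x) * (g (2 * x) - g (2 * x + τ)) := by
        have i1 : S.P τ (S.P x f) = S.P (τ + x) f := (S.semigroup τ hτ x hx0 f).symm
        have i2 : g (2 * x + τ) = ⟪S.P (τ + x) f, S.P x f⟫ := by
          have : 2 * x + τ = (τ + x) + x := by ring
          rw [this]; exact aux_g_add S f (by linarith) hx0
        have i3 : g (2 * x) = ⟪S.P x f, S.P x f⟫ := by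
          rw [two_mul]; exact aux_g_add S f hx0 hx0
        rw [hh, map_smul, i1, ← smul_sub, real_inner_smul_left, real_inner_smul_right,
          inner_sub_left, i2, i3, ← hexp]
        ring
      have h1 := hDs x hx0 τ hτ
      rw [e1]
      have h2 : (g (2 * x + τ) - g (2 * x)) / τ = - (τ⁻¹ * (g (2 * x) - g (2 * x + τ))) := by
        rw [div_eq_inv_mul]; ring
      rw [h2] at h1
      have h3 := mul_le_mul_of_nonneg_left h1 (Real.exp_pos (-(2 * δ) * x)).le
      simp only
      linarith
    have hNash := hN h (hE.trans_lt ENNReal.ofReal_lt_top) hm hl1 hh0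
    rw [hhn, hvφ, hinv_left y hy0, ← hvφ] at hNash
    have hp1 : 0 ≤ -(Real.exp (-(2 * δ) * x) * D x) := by
      have := mul_nonneg (Real.exp_pos (-(2 * δ) * x)).le (neg_nonneg.2 (hDn x hx0))
      linarith
    have hp2 : 0 ≤ δ * v x := mul_nonneg hδ (hvnn x hx0)
    have hNash2 := hNash.trans (add_le_add_left hE _)
    rw [← ENNReal.ofReal_add hp1 hp2, ENNReal.ofReal_le_ofReal_iff (by linarith)] at hNash2
    have hvx : v x = Real.exp (-(2 * δ) * x) * g (2 * x) := rfl
    rw [hvx] at hNash2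
    have hn := hneg y hy0
    have hcn : c₂ * deriv φ y < 0 := mul_neg_of_pos_of_neg hc₂ hn
    simp only [hv', hB']
    rw [← hy]
    linarith
  have hBt : B t ≤ φ (c₂ / 2 * t) := by
    refine hφanti.antitoneOn (a := c₂ / 2 * t) (by simp only [mem_Ioi]; positivity)
      (hypos t (by linarith)) ?_
    linarith
  rw [hvn t ht] at hfin
  have h1 := hfin.trans hBt
  have h2 := mul_le_mul_of_nonneg_left h1 (Real.exp_pos (2 * δ * t)).le
  rw [← mul_assoc, ← Real.exp_add] at h2
  have e : 2 * δ * t + -(2 * δ) * t = 0 := by ring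
  rwa [e, Real.exp_zero, one_mul] at h2

lemma aux_scaled (t K : ℝ) (hK : 0 ≤ K) (ht : 0 < t)
    (h : ∀ f : Lp ℝ 2 μ, MemLp (f : E → ℝ) 1 μ → eLpNorm (f : E → ℝ) 1 μ ≤ 1 →
      ‖S.P t f‖ ^ 2 ≤ K)
    (f : Lp ℝ 2 μ) (hf : MemLp (f : E → ℝ) 1 μ) :
    ‖S.P t f‖ ≤ √K * (eLpNorm (f : E → ℝ) 1 μ).toReal := by
  set N := (eLpNorm (f : E → ℝ) 1 μ).toReal with hN
  have hNe : ENNReal.ofReal N = eLpNorm (f : E → ℝ) 1 μ := ENNReal.ofReal_toReal hf.2.ne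
  rcases eq_or_lt_of_le (show 0 ≤ N from ENNReal.toReal_nonneg) with h0 | h0
  · have hz : eLpNorm (f : E → ℝ) 1 μ = 0 := by rw [← hNe, ← h0]; simp
    rw [eLpNorm_eq_zero_iff hf.1 one_ne_zero] at hz
    have : f = 0 := (Lp.eq_zero_iff_ae_eq_zero).2 hz
    rw [← h0, this]; simp
  · have hco : ((N⁻¹ • f : Lp ℝ 2 μ) : E → ℝ) =ᵐ[μ] N⁻¹ • (f : E → ℝ) := Lp.coeFn_smul _ _
    have hm := (hf.const_smul N⁻¹).ae_eq hco.symm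
    have h1 : eLpNorm ((N⁻¹ • f : Lp ℝ 2 μ) : E → ℝ) 1 μ ≤ 1 := by
      rw [eLpNorm_congr_ae hco, eLpNorm_const_smul, ← hNe,
        Real.enorm_eq_ofReal (inv_nonneg.2 h0.le), ← ENNReal.ofReal_mul (inv_nonneg.2 h0.le),
        inv_mul_cancel₀ h0.ne']
      simp
    have h2 := Real.le_sqrt_of_sq_le (h _ hm h1)
    rw [map_smul, norm_smul, Real.norm_eq_abs, abs_of_pos (inv_pos.2 h0),
      inv_mul_le_iff₀ h0] at h2
    linarith

end

/-- (Equivalence of Nash-type inequality and the on-diagonal upper bound.)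
Let `φ` be a strictly decreasing differentiable bijection of `(0,∞)` onto `(0,∞)` satisfying
condition (D), and `θ(r) = −φ'(φ⁻¹(r))`. Then, for `δ ≥ 0`, ultracontractivity
`‖P_t f‖_∞ ≤ φ(c₁ t) e^{δt} ‖f‖₁` (for some `c₁ > 0`) is equivalent to the Nash-type
inequality `c₂ θ(‖f‖₂²) ≤ E(f,f) + δ‖f‖₂²` (for some `c₂ > 0`) over all `f ∈ F ∩ L¹`
with `‖f‖₁ ≤ 1`, `f ≠ 0`. -/
theorem statement11 {E : Type*} [MeasurableSpace E] (μ : Measure E) [SigmaFinite μ]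
    (S : SymmSubMarkovSemigroup μ) (δ : ℝ) (hδ : 0 ≤ δ)
    (φ φinv : ℝ → ℝ)
    (hφpos : ∀ r > 0, 0 < φ r) (hφanti : StrictAntiOn φ (Ioi 0))
    (hφdiff : ∀ r > 0, DifferentiableAt ℝ φ r)
    (hinv_pos : ∀ r > 0, 0 < φinv r)
    (hinv_left : ∀ r > 0, φinv (φ r) = r)
    (hinv_right : ∀ r > 0, φ (φinv r) = r)
    (hD : ∃ lam > (0 : ℝ), ∀ t > 0, ∀ s ∈ Icc t (2 * t),
      lam * deriv (fun u => -Real.log (φ u)) t ≤ deriv (fun u => -Real.log (φ u)) s) :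
    (∃ c₁ > (0 : ℝ), ∀ t > 0, ∀ f : Lp ℝ 2 μ, MemLp (f : E → ℝ) 1 μ →
        eLpNorm (S.P t f : E → ℝ) ∞ μ ≤
          ENNReal.ofReal (φ (c₁ * t) * Real.exp (δ * t)) * eLpNorm (f : E → ℝ) 1 μ) ↔
    (∃ c₂ > (0 : ℝ), ∀ f : Lp ℝ 2 μ, dirichletForm S f < ∞ → MemLp (f : E → ℝ) 1 μ →
        eLpNorm (f : E → ℝ) 1 μ ≤ 1 → f ≠ 0 →
        ENNReal.ofReal (c₂ * -deriv φ (φinv (‖f‖ ^ 2))) ≤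
          dirichletForm S f + ENNReal.ofReal (δ * ‖f‖ ^ 2)) := by
  obtain ⟨lam, hlam, hD⟩ := hD
  have hneg := aux_deriv_neg φ hφpos hφanti hφdiff lam hlam hD
  constructor
  · rintro ⟨c₁, hc₁, H⟩
    refine ⟨c₁ * lam / 2, by positivity, fun f hE hf hf1 hf0 => ?_⟩
    set G := ‖f‖ ^ 2 with hG
    have hG0 : 0 < G := by
      have := norm_pos_iff.2 hf0
      positivity
    set EE := (dirichletForm S f).toReal with hEE
    have hEe : ENNReal.ofReal EE = dirichletForm S f := ENNReal.ofReal_toReal hE.ne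
    have hEE0 : 0 ≤ EE := ENNReal.toReal_nonneg
    have hlow : ∀ τ > 0, G - τ * EE ≤ ⟪S.P τ f, f⟫ := by
      intro τ hτ
      have h1 : ENNReal.ofReal (τ⁻¹ * ⟪f - S.P τ f, f⟫) ≤ ENNReal.ofReal EE := by
        rw [hEe]
        exact le_iSup (fun t : {t : ℝ // 0 < t} =>
          ENNReal.ofReal ((t : ℝ)⁻¹ * ⟪f - S.P t f, f⟫)) ⟨τ, hτ⟩
      rw [ENNReal.ofReal_le_ofReal_iff hEE0, inv_mul_le_iff₀ hτ, inner_sub_left,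
        real_inner_self_eq_norm_sq] at h1
      linarith
    set s := φinv G with hs
    have hs0 : 0 < s := hinv_pos G hG0
    have hφs : φ s = G := hinv_right G hG0
    set t := 2 * s / c₁ with ht
    have ht0 : 0 < t := by positivity
    have hct : c₁ * t = 2 * s := by rw [ht]; field_simp
    have hexp := aux_exp (fun τ => ⟪S.P τ f, f⟫ / G) (EE / G)
      (fun τ hτ => div_nonneg (aux_g_nonneg S f hτ) hG0.le)
      (fun τ hτ => by
        have := aux_g_half S f hτ
        rw [div_pow, div_le_div_iff₀ (by positivity) hG0]
        calc _ ≤ (⟪S.P τ f, f⟫ * G) * G := mul_le_mul_of_nonneg_right this hG0.le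
          _ = _ := by ring)
      (fun τ hτ => by
        have := hlow τ hτ
        rw [le_div_iff₀ hG0]
        have e : (1 - τ * (EE / G)) * G = G - τ * EE := by field_simp
        linarith) t ht0
    have hφ2 : 0 < φ (2 * s) := hφpos _ (by positivity)
    have hup : ⟪S.P t f, f⟫ ≤ φ (2 * s) * Real.exp (δ * t) := by
      refine aux_pair (S.P t f) f _ (by positivity) hf hf1 ?_
      have := H t ht0 f hf
      rw [hct] at this
      refine this.trans ?_
      calc _ ≤ ENNReal.ofReal (φ (2 * s) * Real.exp (δ * t)) * 1 := by gcongr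
        _ = _ := mul_one _
    rw [le_div_iff₀ hG0] at hexp
    have hlog := Real.log_le_log (by positivity) (hexp.trans hup)
    rw [Real.log_mul (Real.exp_pos _).ne' hG0.ne', Real.log_mul hφ2.ne' (Real.exp_pos _).ne',
      Real.log_exp, Real.log_exp] at hlog
    obtain ⟨x, hx, hx'⟩ := exists_deriv_eq_slope (fun u => -Real.log (φ u))
      (show s < 2 * s by linarith)
      (fun u hu => (aux_deriv_log φ hφpos hφdiff
        (lt_of_lt_of_le hs0 hu.1)).continuousAt.continuousWithinAt)
      (fun u hu => (aux_deriv_log φ hφpos hφdiff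
        (hs0.trans hu.1)).differentiableAt.differentiableWithinAt)
    have hDx := hD s hs0 x ⟨hx.1.le, hx.2.le⟩
    have e1 : 2 * s - s = s := by ring
    rw [hx', (aux_deriv_log φ hφpos hφdiff hs0).deriv, hφs, e1, le_div_iff₀ hs0] at hDx
    have hfinal : lam * -(deriv φ s / G) * s ≤ t * (EE / G) + δ * t := by linarith
    have hfin2 : c₁ * lam / 2 * -deriv φ s ≤ EE + δ * G := by
      have h3 := mul_le_mul_of_nonneg_right hfinal (show 0 ≤ G * (c₁ / (2 * s)) by positivity)
      have e3 : lam * -(deriv φ s / G) * s * (G * (c₁ / (2 * s))) = c₁ * lam / 2 * -deriv φ s := by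
        field_simp
      have e4 : (t * (EE / G) + δ * t) * (G * (c₁ / (2 * s))) = EE + δ * G := by
        rw [ht]; field_simp
      rwa [e3, e4] at h3
    rw [← hEe, ← ENNReal.ofReal_add hEE0 (by positivity)]
    exact ENNReal.ofReal_le_ofReal hfin2
  · rintro ⟨c₂, hc₂, H⟩
    refine ⟨c₂ / 4, by positivity, fun t ht f hf => ?_⟩
    have ht2 : 0 < t / 2 := half_pos ht
    set K := φ (c₂ / 4 * t) * Real.exp (δ * t) with hK
    have hK0 : 0 < K := mul_pos (hφpos _ (by positivity)) (Real.exp_pos _)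
    have hsc := aux_scaled S (t / 2) K hK0.le ht2 (fun f hf hf1 => by
      have := aux_core S δ hδ φ φinv hφpos hφanti hφdiff hinv_pos hinv_left hinv_right hneg
        c₂ hc₂ H f hf hf1 (t / 2) ht2
      have e1 : 2 * δ * (t / 2) = δ * t := by ring
      have e2 : c₂ / 2 * (t / 2) = c₂ / 4 * t := by ring
      rw [e1, e2, mul_comm] at this
      exact this)
    have hNe : ENNReal.ofReal (eLpNorm (f : E → ℝ) 1 μ).toReal = eLpNorm (f : E → ℝ) 1 μ :=
      ENNReal.ofReal_toReal hf.2.ne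
    rw [← hNe, ← ENNReal.ofReal_mul hK0.le]
    refine aux_dual _ _ (mul_nonneg hK0.le ENNReal.toReal_nonneg) fun k hk => ?_
    have e : S.P t f = S.P (t / 2) (S.P (t / 2) f) := by
      rw [← S.semigroup _ ht2 _ ht2, add_halves]
    rw [e, ← S.symm _ ht2]
    refine (abs_real_inner_le_norm _ _).trans ?_
    refine (mul_le_mul (hsc k hk) (hsc f hf) (norm_nonneg _) (by positivity)).trans_eq ?_
    have := Real.mul_self_sqrt hK0.le
    linear_combination (eLpNorm (k : E → ℝ) 1 μ).toReal * (eLpNorm (f : E → ℝ) 1 μ).toReal * this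
end
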